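/- arXiv:2112.15587 — 4 statements merged into one kernel-verified Lean document; each statement's English description precedes it below -/
import Mathlib

section
/- In the group L(2,5,5) with canonical element c and dualizing element w, define S = { x ∈ L : 0 ≤ x and x ≤ n·w + c for every n ≥ 2 }. Then S = {0, x2, x3, 2·x2, 2·x3}. -/
/-- The subgroup of relations defining L(p₁,p₂,p₃): p₁·x₁ = p₂·x₂ = p₃·x₃. -/
def LRel (p₁ p₂ p₃ : ℕ) : AddSubgroup (ℤ × ℤ × ℤ) :=
  AddSubgroup.closure {((p₁ : ℤ), -(p₂ : ℤ), (0 : ℤ)), ((0 : ℤ), (p₂ : ℤ), -(p₃ : ℤ))}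

/-- The rank-one abelian group L(p₁,p₂,p₃) on generators x₁,x₂,x₃ with
p₁·x₁ = p₂·x₂ = p₃·x₃. -/
abbrev LGrp (p₁ p₂ p₃ : ℕ) := (ℤ × ℤ × ℤ) ⧸ LRel p₁ p₂ p₃

def lx₁ (p₁ p₂ p₃ : ℕ) : LGrp p₁ p₂ p₃ := QuotientAddGroup.mk ((1 : ℤ), 0, 0)
def lx₂ (p₁ p₂ p₃ : ℕ) : LGrp p₁ p₂ p₃ := QuotientAddGroup.mk ((0 : ℤ), 1, 0)
def lx₃ (p₁ p₂ p₃ : ℕ) : LGrp p₁ p₂ p₃ := QuotientAddGroup.mk ((0 : ℤ), 0, 1)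

/-- The canonical element c = p₁·x₁. -/
def lc (p₁ p₂ p₃ : ℕ) : LGrp p₁ p₂ p₃ := (p₁ : ℤ) • lx₁ p₁ p₂ p₃

/-- The dualizing element ω = c - x₁ - x₂ - x₃. -/
def lw (p₁ p₂ p₃ : ℕ) : LGrp p₁ p₂ p₃ :=
  lc p₁ p₂ p₃ - lx₁ p₁ p₂ p₃ - lx₂ p₁ p₂ p₃ - lx₃ p₁ p₂ p₃

/-- The partial order on L: u ≤ v iff v - u is a nonnegative integer combination
of x₁, x₂, x₃. -/
def lle (p₁ p₂ p₃ : ℕ) (u v : LGrp p₁ p₂ p₃) : Prop :=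
  ∃ a b c : ℕ, v = u + (a : ℤ) • lx₁ p₁ p₂ p₃ + (b : ℤ) • lx₂ p₁ p₂ p₃ + (c : ℤ) • lx₃ p₁ p₂ p₃

/-- The set S = { x | 0 ≤ x ≤ n·ω + c for all n ≥ 2 }. -/
def lS (p₁ p₂ p₃ : ℕ) : Set (LGrp p₁ p₂ p₃) :=
  {x | lle p₁ p₂ p₃ 0 x ∧ ∀ n : ℕ, 2 ≤ n → lle p₁ p₂ p₃ x ((n : ℤ) • lw p₁ p₂ p₃ + lc p₁ p₂ p₃)}

theorem LGrp.mk_eq_mk_iff {p₁ p₂ p₃ : ℕ} {a b d a' b' d' : ℤ} :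
    (QuotientAddGroup.mk (a, b, d) : LGrp p₁ p₂ p₃) = QuotientAddGroup.mk (a', b', d') ↔
      ∃ s t : ℤ, a' = a + p₁ * s ∧ b' = b - p₂ * s + p₂ * t ∧ d' = d - p₃ * t := by
  rw [QuotientAddGroup.eq, LRel, AddSubgroup.mem_closure_pair]
  refine exists_congr fun s => exists_congr fun t => ?_
  simp only [Prod.smul_mk, Prod.mk_add_mk, Prod.neg_mk, Prod.mk.injEq, smul_eq_mul]
  constructor <;> rintro ⟨h₁, h₂, h₃⟩ <;> refine ⟨?_, ?_, ?_⟩ <;> linarith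

theorem LGrp.mk_eq_combination {p₁ p₂ p₃ : ℕ} (a b d : ℤ) :
    (QuotientAddGroup.mk (a, b, d) : LGrp p₁ p₂ p₃) =
      a • lx₁ p₁ p₂ p₃ + b • lx₂ p₁ p₂ p₃ + d • lx₃ p₁ p₂ p₃ := by
  simp only [lx₁, lx₂, lx₃, ← QuotientAddGroup.mk_zsmul, ← QuotientAddGroup.mk_add]
  simp

theorem lle_mk_iff {p₁ p₂ p₃ : ℕ} {a b d a' b' d' : ℤ} :
    lle p₁ p₂ p₃ (QuotientAddGroup.mk (a, b, d)) (QuotientAddGroup.mk (a', b', d')) ↔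
      ∃ s t : ℤ, a ≤ a' + p₁ * s ∧ b ≤ b' - p₂ * s + p₂ * t ∧ d ≤ d' - p₃ * t := by
  have key (k l m : ℕ) :
      (QuotientAddGroup.mk (a, b, d) : LGrp p₁ p₂ p₃) + (k : ℤ) • lx₁ p₁ p₂ p₃
        + (l : ℤ) • lx₂ p₁ p₂ p₃ + (m : ℤ) • lx₃ p₁ p₂ p₃
        = QuotientAddGroup.mk (a + k, b + l, d + m) := by
    simp only [LGrp.mk_eq_combination]
    module
  simp only [lle, key, LGrp.mk_eq_mk_iff]
  constructor
  · rintro ⟨k, l, m, s, t, h₁, h₂, h₃⟩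
    exact ⟨s, t, by omega, by omega, by omega⟩
  · rintro ⟨s, t, h₁, h₂, h₃⟩
    obtain ⟨k, hk⟩ := Int.le.dest h₁
    obtain ⟨l, hl⟩ := Int.le.dest h₂
    obtain ⟨m, hm⟩ := Int.le.dest h₃
    exact ⟨k, l, m, s, t, hk, hl, hm⟩

theorem smul_lw_add_lc (p₁ p₂ p₃ : ℕ) (n : ℤ) :
    n • lw p₁ p₂ p₃ + lc p₁ p₂ p₃ = QuotientAddGroup.mk ((n + 1) * p₁ - n, -n, -n) := by
  rw [LGrp.mk_eq_combination, lw, lc]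
  module

theorem mk_mem_lS_255_iff {a b d : ℕ} :
    (QuotientAddGroup.mk ((a : ℤ), (b : ℤ), (d : ℤ)) : LGrp 2 5 5) ∈ lS 2 5 5 ↔
      a = 0 ∧ b ≤ 2 ∧ d ≤ 2 ∧ (b = 0 ∨ d = 0) := by
  have zero_eq : (0 : LGrp 2 5 5) = QuotientAddGroup.mk ((0 : ℤ), (0 : ℤ), (0 : ℤ)) := rfl
  simp only [lS, Set.mem_ofPred_eq, zero_eq, smul_lw_add_lc, lle_mk_iff]
  constructor
  · rintro ⟨-, h⟩
    obtain ⟨s₂, t₂, h₂⟩ := h 2 le_rfl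
    obtain ⟨s₃, t₃, h₃⟩ := h 3 (by norm_num)
    obtain ⟨s₅, t₅, h₅⟩ := h 5 (by norm_num)
    omega
  · rintro ⟨rfl, hb, hd, hbd⟩
    refine ⟨⟨0, 0, by omega⟩, fun n hn => ?_⟩
    refine ⟨-((n + b + 4) / 5) - (n + d + 4) / 5, -((n + d + 4) / 5), ?_⟩
    obtain hn | hn := le_or_gt 6 n
    · omega
    · interval_cases n <;> omega

/-- For weight type (2,5,5), S = {0, x₂, x₃, 2x₂, 2x₃}. -/
theorem S_255 :
    lS 2 5 5 = {0, lx₂ 2 5 5, lx₃ 2 5 5, (2 : ℤ) • lx₂ 2 5 5, (2 : ℤ) • lx₃ 2 5 5} := by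
  have mk_nat (b d : ℕ) : (b : ℤ) • lx₂ 2 5 5 + (d : ℤ) • lx₃ 2 5 5 =
      QuotientAddGroup.mk (((0 : ℕ) : ℤ), (b : ℤ), (d : ℤ)) := by
    simp [LGrp.mk_eq_combination]
  ext x
  simp only [Set.mem_insert_iff, Set.mem_singleton_iff]
  constructor
  · intro hx
    obtain ⟨a, b, d, rfl⟩ := hx.1
    have hmk : (0 : LGrp 2 5 5) + (a : ℤ) • lx₁ 2 5 5 + (b : ℤ) • lx₂ 2 5 5
        + (d : ℤ) • lx₃ 2 5 5 = QuotientAddGroup.mk ((a : ℤ), (b : ℤ), (d : ℤ)) := by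
      rw [LGrp.mk_eq_combination, zero_add]
    rw [hmk, mk_mem_lS_255_iff] at hx
    obtain ⟨rfl, hb, hd, rfl | rfl⟩ := hx
    · interval_cases d <;> simp
    · interval_cases b <;> simp
  · have mem (b d : ℕ) (h : b ≤ 2 ∧ d ≤ 2 ∧ (b = 0 ∨ d = 0)) :
        (b : ℤ) • lx₂ 2 5 5 + (d : ℤ) • lx₃ 2 5 5 ∈ lS 2 5 5 := by
      rw [mk_nat, mk_mem_lS_255_iff]
      exact ⟨rfl, h⟩
    rintro (rfl | rfl | rfl | rfl | rfl)
    · simpa using mem 0 0 (by norm_num)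
    · simpa using mem 1 0 (by norm_num)
    · simpa using mem 0 1 (by norm_num)
    · simpa using mem 2 0 (by norm_num)
    · simpa using mem 0 2 (by norm_num)
end

section
/- With the Cartan matrix C of N_n(r) defined by C_{ij} = 1 iff i ≤ j ≤ i + r − 1 and Coxeter matrix Φ = −C^{-T}·C, the Coxeter polynomial of N_{16}(9) equals (λ+1)(λ^{6} − λ^{3} + 1)(λ^{9} + 1), and it coincides with the Coxeter polynomial of N_{16}(3). -/
open Polynomial Matrix

/-- The Cartan matrix of the Nakayama algebra N_n(r): C i j = 1 iff i ≤ j ≤ i + r - 1. -/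
def cartanN (n r : ℕ) : Matrix (Fin n) (Fin n) ℚ :=
  fun i j => if (i : ℕ) ≤ (j : ℕ) ∧ (j : ℕ) ≤ (i : ℕ) + (r - 1) then 1 else 0

/-- The Coxeter matrix Φ = -C^{-T}·C of N_n(r). -/
noncomputable def coxeterN (n r : ℕ) : Matrix (Fin n) (Fin n) ℚ :=
  -((cartanN n r)⁻¹)ᵀ * cartanN n r

/-- The Coxeter polynomial of N_n(r): the characteristic polynomial det(λ·I - Φ). -/
noncomputable def coxeterPolyN (n r : ℕ) : Polynomial ℚ :=
  (coxeterN n r).charpoly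

/-- The companion matrix with ones on the superdiagonal and last row `c`. -/
def companion {R : Type*} [CommRing R] {n : ℕ} (c : Fin n → R) : Matrix (Fin n) (Fin n) R :=
  fun i j => (if (j : ℕ) = i + 1 then 1 else 0) + if (i : ℕ) + 1 = n then c j else 0

theorem charpoly_companion {R : Type*} [CommRing R] {n : ℕ} (c : Fin n → R) :
    (companion c).charpoly = X ^ n - ∑ i, C (c i) * X ^ (i : ℕ) := by
  induction n with
  | zero => simp [Matrix.charpoly]
  | succ n ih =>
    have entry (i : Fin (n + 1)) : charmatrix (companion c) i 0 =
        (if i = 0 then X else 0) - if i = Fin.last n then C (c 0) else 0 := by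
      have h : ((i : ℕ) = n) = (i = Fin.last n) := by simp [Fin.ext_iff]
      rw [charmatrix_apply, diagonal_apply]
      simp only [companion, Fin.val_zero, Nat.add_right_cancel_iff, h]
      split_ifs <;> simp_all
    have top : (charmatrix (companion c)).submatrix (Fin.succAbove 0) Fin.succ =
        charmatrix (companion fun i => c i.succ) := by
      ext1 i j
      simp [charmatrix_apply, diagonal_apply, companion]
    have bottom : ((charmatrix (companion c)).submatrix
        (Fin.succAbove (Fin.last n)) Fin.succ).det = (-1) ^ n := by
      rw [det_of_isLowerTriangular]
      · simp [companion, Fin.ext_iff, (Fin.is_lt _).ne]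
      · intro i j hij
        replace hij : (i : ℕ) < j := hij
        simp [companion, Fin.ext_iff, hij.ne', i.is_lt.ne,
          show (i : ℕ) ≠ j + 1 by lia]
    rw [Matrix.charpoly, det_succ_column_zero]
    simp only [entry, mul_sub, sub_mul, Finset.sum_sub_distrib, mul_ite, ite_mul, mul_zero,
      zero_mul, Finset.sum_ite_eq', Finset.mem_univ, if_true, top, bottom]
    rw [← Matrix.charpoly, ih, Fin.sum_univ_succ]
    have hsign : ((-1 : R[X]) ^ n) * (-1) ^ n = 1 := by rw [← mul_pow]; simp
    have hsum : ∑ i : Fin n, C (c i.succ) * X ^ (i.succ : ℕ) =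
        X * ∑ i : Fin n, C (c i.succ) * X ^ (i : ℕ) := by
      rw [Finset.mul_sum]
      exact Finset.sum_congr rfl fun i _ => by rw [Fin.val_succ]; ring
    rw [hsum, Fin.val_zero, Fin.val_last]
    linear_combination -C (c 0) * hsign

theorem coxeterPolyN_eq_charpoly {n r : ℕ} {F : Matrix (Fin n) (Fin n) ℚ}
    (R Q : Matrix (Fin n) (Fin n) ℚ) (hQ : R * (cartanN n r)ᵀ * Q = 1)
    (hF : R * cartanN n r = -(F * (R * (cartanN n r)ᵀ))) :
    coxeterPolyN n r = F.charpoly := by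
  have hinv : (cartanN n r)ᵀ⁻¹ = Q * R :=
    inv_eq_left_inv <| by rw [Matrix.mul_assoc]; exact mul_eq_one_comm.mp hQ
  have hcox : coxeterN n r = Q * (F * (R * (cartanN n r)ᵀ)) := by
    rw [coxeterN, transpose_nonsing_inv, hinv, Matrix.neg_mul, Matrix.mul_assoc, hF,
      Matrix.mul_neg, neg_neg]
  rw [coxeterPolyN, hcox, charpoly_mul_comm, Matrix.mul_assoc, hQ, Matrix.mul_one]

/-- The common rational canonical form of the Coxeter matrices of N₁₆(9) and N₁₆(3), with
invariant factors `X ^ 9 + 1` and `X ^ 7 + X ^ 6 - X ^ 4 - X ^ 3 + X + 1`. -/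
def rationalForm : Matrix (Fin 16) (Fin 16) ℚ :=
  reindex finSumFinEquiv finSumFinEquiv <| fromBlocks
    (companion ![-1, 0, 0, 0, 0, 0, 0, 0, 0]) 0 0 (companion ![-1, -1, 0, 1, 1, 0, -1])

theorem charpoly_rationalForm : rationalForm.charpoly =
    (X ^ 9 + 1) * (X ^ 7 + X ^ 6 - X ^ 4 - X ^ 3 + X + 1) := by
  rw [rationalForm, charpoly_reindex, charpoly_fromBlocks_zero₁₂, charpoly_companion,
    charpoly_companion]
  congr 1
  · simp [Fin.sum_univ_succ]
  · simp [Fin.sum_univ_succ]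
    ring

theorem coxeterPolyN_sixteen_nine :
    coxeterPolyN 16 9 = (X ^ 9 + 1) * (X ^ 7 + X ^ 6 - X ^ 4 - X ^ 3 + X + 1) := by
  rw [← charpoly_rationalForm]
  exact coxeterPolyN_eq_charpoly
   !![-1, 1, 0, 0, 0, 0, 0, 0, 0, 0, 0, 0, 0, 0, 0, 0;
    0, 0, 0, 0, 0, 0, 0, 0, 1, -1, 0, 0, 0, 0, 0, 0;
    0, 0, 0, 0, 0, 0, 0, 1, -1, 0, 0, 0, 0, 0, 0, 0;
    0, 0, 0, 0, 0, 0, 1, -1, 0, 0, 0, 0, 0, 0, 0, 0;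
    0, 0, 0, 0, 0, 0, 0, 0, 0, 0, 0, 0, 0, 0, -1, 1;
    0, 0, 0, 0, -1, 1, 0, 0, 0, 0, 0, 0, 0, -1, 1, 0;
    0, 0, 0, -1, 1, 0, 0, 0, 0, 0, 0, 0, 0, 0, 0, 0;
    0, 0, 0, 0, 0, 0, 0, 0, 0, 0, 0, 1, -1, 0, 0, 0;
    0, 1, -1, 0, 0, 0, 0, 0, 0, 0, 1, -1, 0, 0, 0, 0;
    -1, 1, 0, 0, 0, -1, 1, 0, 0, 0, 0, 0, 0, 0, -1, 1;
    0, 0, 0, 0, -1, 1, 0, 0, 1, -1, 0, 0, 0, 0, 0, 0;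
    0, 0, 0, 0, 0, 0, 0, 1, -1, 0, 0, 0, 1, -1, 0, 0;
    0, 0, 1, -1, 0, 0, 1, -1, 0, 0, 0, 1, -1, 0, 0, 0;
    0, 1, -1, 0, 0, 0, 0, 0, 0, 0, 0, 0, 0, 0, -1, 1;
    0, 0, 0, 0, -1, 1, 0, 0, 0, -1, 1, 0, 0, -1, 1, 0;
    1, 0, 0, -1, 1, 0, 0, 0, -1, 1, 0, 0, 0, 0, 0, 0]
   !![0, 1, 0, 0, 0, 0, -1, 0, 0, 0, 0, 0, 0, 0, 0, 1;
    1, 0, 0, 0, 0, 0, 0, 0, 0, 0, 0, 0, 0, 0, 0, 0;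
    0, 0, 0, 0, 1, 0, 0, 0, 0, 0, 0, 0, 0, -1, 0, 0;
    0, 0, 0, 1, 0, 0, 0, 1, 0, 0, 0, 0, -1, 0, 0, 0;
    0, 0, 0, 0, 0, 0, 1, 0, 0, 0, 0, 0, 0, 0, 0, 0;
    0, -1, 0, 0, 0, 0, 0, 0, 0, 0, 1, 0, 0, 0, 0, 0;
    -1, 0, 0, 0, -1, 0, 0, 0, 0, 1, 0, 0, 0, 0, 0, 0;
    0, 0, 0, -1, 0, 0, 0, 0, 0, 0, 0, 0, 0, 0, 0, 0;
    0, 0, -1, 0, 0, 0, 0, 0, 0, 0, 0, 0, 0, 0, 0, 0;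
    0, 0, 0, 0, 0, 0, -1, 0, 0, 0, 0, 0, 0, 0, 0, 1;
    1, 0, 0, 0, 0, -1, 0, 0, 0, 0, 0, 0, 0, 0, 1, 0;
    0, 0, 0, 0, 0, 0, 0, 0, -1, 0, 0, 0, 0, 0, 0, 0;
    0, 0, 0, 1, 0, 0, 0, 0, 0, 0, 0, 0, -1, 0, 0, 0;
    0, 0, 1, 0, 0, 0, 1, 0, 0, 0, 0, -1, 0, 0, 0, 0;
    0, 0, 0, 0, 0, 1, 0, 0, 0, 0, 0, 0, 0, 0, 0, 0;
    -1, 0, 0, 0, 0, 0, 0, 0, 0, 1, 0, 0, 0, 0, 0, 0]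
   (by decide +kernel) (by decide +kernel)

theorem coxeterPolyN_sixteen_three :
    coxeterPolyN 16 3 = (X ^ 9 + 1) * (X ^ 7 + X ^ 6 - X ^ 4 - X ^ 3 + X + 1) := by
  rw [← charpoly_rationalForm]
  exact coxeterPolyN_eq_charpoly
   !![-1, 1, 0, 0, 0, 0, 0, 0, 0, 0, 0, 0, 0, 0, 0, 0;
    0, 0, 1, -1, 0, 0, 0, 0, 0, 0, 0, 0, 0, 0, 0, 0;
    0, 0, 0, 0, -1, 1, 0, 0, 0, 0, 0, 0, 0, 0, 0, 0;
    0, 0, 0, 0, 0, 0, 1, -1, 0, 0, 0, 0, 0, 0, 0, 0;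
    0, 0, 0, 0, 0, 0, 0, 0, -1, 1, 0, 0, 0, 0, 0, 0;
    0, 0, 0, 0, 0, 0, 0, 0, 0, 0, 1, -1, 0, 0, 0, 0;
    0, 0, 0, 0, 0, 0, 0, 0, 0, 0, 0, 0, -1, 1, 0, 0;
    0, 0, 0, 0, 0, 0, 0, 0, 0, 0, 0, 0, 0, 0, 1, -1;
    0, 1, -1, 0, 1, -1, 0, 1, -1, 0, 1, -1, 0, 1, -1, 0;
    1, -1, 0, 1, -1, 0, 1, -1, 1, 0, 0, 0, 0, 0, 0, 0;
    0, 0, -1, 1, 0, -1, 1, 0, -1, 1, -1, 0, 0, 0, 0, 0;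
    0, 0, 0, 0, 1, -1, 0, 1, -1, 0, 1, -1, 1, 0, 0, 0;
    0, 0, 0, 0, 0, 0, -1, 1, 0, -1, 1, 0, -1, 1, -1, 0;
    1, -1, 0, 1, -1, 0, 1, -1, 1, 0, -1, 1, 0, -1, 1, 0;
    -1, 1, -1, 0, 1, -1, 0, 1, -1, 0, 0, 0, 0, 0, 0, 0;
    0, 0, 1, -1, 1, 0, -1, 1, 0, -1, 1, 0, 0, 0, 0, 0]
   !![0, 0, 0, 0, 0, 0, 0, 0, 1, -1, 0, 0, 0, 1, -1, 0;
    1, 0, 0, 0, 0, 0, 0, 0, 0, 0, 0, 0, 0, 0, 0, 0;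
    0, 0, 0, 0, 0, 0, 0, 0, -1, 1, 1, 0, 0, -1, 0, 1;
    0, -1, 0, 0, 0, 0, 0, 0, 1, -1, 0, 0, 0, 1, -1, 0;
    0, 0, 0, 0, 0, 0, 0, 0, 0, 1, 0, -1, -1, -1, 1, 1;
    0, 0, 1, 0, 0, 0, 0, 0, -1, 1, 1, 0, 0, -1, 0, 1;
    0, 0, 0, 0, 0, 0, 0, 0, 1, 0, 0, 0, 0, 1, 0, 0;
    0, 0, 0, -1, 0, 0, 0, 0, 0, 1, 0, -1, -1, -1, 1, 1;
    0, 0, 0, 0, 0, 0, 0, 0, -1, 1, 0, 0, 0, -1, 0, 0;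
    0, 0, 0, 0, 1, 0, 0, 0, 1, 0, 0, 0, 0, 1, 0, 0;
    0, 0, 0, 0, 0, 0, 0, 0, 0, 0, -1, 0, 0, 0, 1, 0;
    0, 0, 0, 0, 0, -1, 0, 0, -1, 1, 0, 0, 0, -1, 0, 0;
    0, 0, 0, 0, 0, 0, 0, 0, 1, -1, 0, 1, 0, 1, -1, -1;
    0, 0, 0, 0, 0, 0, 1, 0, 0, 0, -1, 0, 0, 0, 1, 0;
    0, 0, 0, 0, 0, 0, 0, 0, -1, 0, 0, 0, 0, 0, 0, 0;
    0, 0, 0, 0, 0, 0, 0, -1, 1, -1, 0, 1, 0, 1, -1, -1]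
   (by decide +kernel) (by decide +kernel)

/-- The Coxeter polynomial of N₁₆(9) equals (λ+1)(λ⁶-λ³+1)(λ⁹+1), and coincides
with that of N₁₆(3). -/
theorem coxeterPoly_16_9 :
    coxeterPolyN 16 9 = (X + 1) * (X ^ 6 - X ^ 3 + 1) * (X ^ 9 + 1) ∧
    coxeterPolyN 16 9 = coxeterPolyN 16 3 := by
  rw [coxeterPolyN_sixteen_nine, coxeterPolyN_sixteen_three]
  exact ⟨by ring, rfl⟩
end

section
/- With the Cartan matrix C of N_{15}(5) (C_{ij} = 1 iff i ≤ j ≤ i + 4, size 15×15) and Coxeter matrix Φ = −C^{-T}·C, the Coxeter polynomial equals (λ+1)(λ^4+1)(λ^5+1)^2, and the Coxeter number (the multiplicative order of Φ) equals 40. -/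
open Polynomial Matrix

/-- The companion matrix of `X ^ d + 1`. -/
def negacyclicShift (d : ℕ) : Matrix (Fin d) (Fin d) ℚ :=
  fun i j => if (i : ℕ) = j + 1 then 1 else if (i : ℕ) = 0 ∧ (j : ℕ) + 1 = d then -1 else 0

theorem charpoly_negacyclicShift_five : (negacyclicShift 5).charpoly = X ^ 5 + 1 := by
  simp [charpoly, charmatrix, negacyclicShift, det_succ_row_zero, Fin.sum_univ_succ, Fin.succAbove]
  ring

theorem charpoly_negacyclicShift_four : (negacyclicShift 4).charpoly = X ^ 4 + 1 := by
  simp [charpoly, charmatrix, negacyclicShift, det_succ_row_zero, Fin.sum_univ_succ, Fin.succAbove]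
  ring

theorem charpoly_negacyclicShift_one : (negacyclicShift 1).charpoly = X + 1 := by
  simp [charpoly, charmatrix, negacyclicShift]

theorem negacyclicShift_five_pow : negacyclicShift 5 ^ 5 = -1 := by
  decide +kernel

theorem negacyclicShift_four_pow : negacyclicShift 4 ^ 4 = -1 := by
  decide +kernel

theorem negacyclicShift_one : negacyclicShift 1 = -1 := by
  decide +kernel

/-- The rational canonical form of the Coxeter matrix of `N_15(5)`. -/
def coxeterForm :
    Matrix ((Fin 5 ⊕ Fin 5) ⊕ (Fin 4 ⊕ Fin 1)) ((Fin 5 ⊕ Fin 5) ⊕ (Fin 4 ⊕ Fin 1)) ℚ :=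
  fromBlocks (fromBlocks (negacyclicShift 5) 0 0 (negacyclicShift 5)) 0 0
    (fromBlocks (negacyclicShift 4) 0 0 (negacyclicShift 1))

theorem charpoly_coxeterForm :
    coxeterForm.charpoly = (X + 1) * (X ^ 4 + 1) * (X ^ 5 + 1) ^ 2 := by
  simp only [coxeterForm, charpoly_fromBlocks_zero₁₂, charpoly_negacyclicShift_five,
    charpoly_negacyclicShift_four, charpoly_negacyclicShift_one]
  ring

theorem coxeterForm_pow (k : ℕ) : coxeterForm ^ k =
    fromBlocks (fromBlocks (negacyclicShift 5 ^ k) 0 0 (negacyclicShift 5 ^ k)) 0 0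
      (fromBlocks (negacyclicShift 4 ^ k) 0 0 (negacyclicShift 1 ^ k)) := by
  simp only [coxeterForm, fromBlocks_diagonal_pow]

theorem coxeterForm_pow_forty : coxeterForm ^ 40 = 1 := by
  rw [coxeterForm_pow, show 40 = 5 * 8 from rfl, pow_mul (negacyclicShift 5),
    negacyclicShift_five_pow, show 5 * 8 = 4 * 10 from rfl, pow_mul (negacyclicShift 4),
    negacyclicShift_four_pow, negacyclicShift_one]
  simp [Even.neg_one_pow (show Even 10 by decide), Even.neg_one_pow (show Even 8 by decide),
    Even.neg_one_pow (show Even 40 by decide)]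

theorem coxeterForm_pow_twenty_ne_one : coxeterForm ^ 20 ≠ 1 := by
  intro h
  rw [coxeterForm_pow, ← fromBlocks_one, fromBlocks_inj, ← fromBlocks_one (l := Fin 4),
    fromBlocks_inj, show 20 = 4 * 5 from rfl, pow_mul (negacyclicShift 4),
    negacyclicShift_four_pow] at h
  exact absurd h.2.2.2.1 (by decide +kernel)

theorem coxeterForm_pow_eight_ne_one : coxeterForm ^ 8 ≠ 1 := by
  intro h
  rw [coxeterForm_pow, ← fromBlocks_one, fromBlocks_inj, ← fromBlocks_one (l := Fin 5),
    fromBlocks_inj] at h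
  exact absurd h.1.1 (by decide +kernel)

theorem orderOf_coxeterForm : orderOf coxeterForm = 40 := by
  refine orderOf_eq_of_pow_and_pow_div_prime (by norm_num) coxeterForm_pow_forty fun p hp hd => ?_
  have h : p ∣ 2 ^ 3 * 5 := hd
  obtain h | h := hp.dvd_mul.1 h
  · rw [(Nat.prime_dvd_prime_iff_eq hp Nat.prime_two).1 (hp.dvd_of_dvd_pow h)]
    exact coxeterForm_pow_twenty_ne_one
  · rw [(Nat.prime_dvd_prime_iff_eq hp Nat.prime_five).1 h]
    exact coxeterForm_pow_eight_ne_one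

/-- The concatenation of the blocks of `coxeterForm`. -/
def coxeterFormEquiv : (Fin 5 ⊕ Fin 5) ⊕ (Fin 4 ⊕ Fin 1) ≃ Fin 15 :=
  (Equiv.sumCongr finSumFinEquiv finSumFinEquiv).trans finSumFinEquiv

/-- A basis bringing the Coxeter matrix of `N_15(5)` into the form `coxeterForm`. -/
def coxeterBasis : Matrix (Fin 15) (Fin 15) ℚ :=
  !![0, 0, 0, 0, -1, 0, 0, 1, 0, 0, 0, 0, 1, 0, -1;
     0, 0, -1, 1, 0, 0, 0, 0, 0, 0, 0, 0, 0, 0, 1;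
     0, 0, 0, -1, 1, 1, -1, 0, 0, 0, 0, 0, 0, 0, 1;
     0, 0, 1, 0, 0, -1, 1, -1, 0, 0, 0, -1, 0, 0, -1;
     0, 0, 0, 1, 0, 0, -1, 0, 0, 0, 0, 0, -1, 0, -1;
     0, 1, -1, 0, -1, 0, 0, 1, 0, 0, 0, 0, 1, 0, 0;
     0, 0, 0, 0, 0, 1, 0, 0, 0, 1, 0, 0, 0, 0, 2;
     0, -1, 0, -1, 1, 0, 0, 0, 0, -1, 1, 0, 0, 0, 0;
     0, 0, 0, 0, 0, 0, 1, -1, 0, 0, 0, 0, 0, 0, -2;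
     -1, 1, 0, 1, 0, 0, -1, 0, 0, 0, 0, 0, -1, 0, 0;
     0, 0, 0, 0, -1, 0, 0, 1, -1, 1, 0, 0, 1, 0, 1;
     1, 0, 0, 0, 0, 0, 0, 0, 1, 0, 0, 0, 0, 1, 1;
     0, 0, 0, -1, 1, 0, 0, 0, 0, 0, 0, 0, 0, 0, -1;
     -1, 0, 0, 0, -1, 0, 1, -1, 0, 0, 0, 0, 0, 0, -1;
     0, 0, 0, 1, 0, 0, -1, 1, -1, 0, 0, 0, -1, 0, 1]

/-- Ten times the inverse of `coxeterBasis`. -/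
def coxeterBasisInvTen : Matrix (Fin 15) (Fin 15) ℚ :=
  !![-6, -5, 0, 0, 4, 5, 0, 0, 4, -5, 0, 0, -6, -5, 0;
     -4, -5, 0, 0, -4, 5, 0, 0, 6, 5, 0, 0, -4, -5, 0;
     4, -5, 0, 0, -6, -5, 0, 0, 4, 5, 0, 0, -6, -5, 0;
     6, 5, 0, 0, -4, -5, 0, 0, 6, 5, 0, 0, -4, -5, 0;
     4, 5, 0, 0, -6, -5, 0, 0, 4, 5, 0, 0, 4, -5, 0;
     7, 0, 5, 0, -3, 0, 5, 0, 7, 0, -5, 0, -3, 0, 5;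
     3, 0, -5, 0, -7, 0, 5, 0, 3, 0, -5, 0, 3, 0, 5;
     7, 0, -5, 0, -3, 0, 5, 0, -3, 0, -5, 0, 7, 0, 5;
     3, 0, -5, 0, 3, 0, 5, 0, -7, 0, -5, 0, 3, 0, -5;
     -3, 0, -5, 0, 7, 0, 5, 0, -3, 0, 5, 0, 7, 0, -5;
     -5, -5, -5, 0, 5, 5, 5, 10, 5, 5, 5, 0, -5, -5, -5;
     -5, -5, -5, -10, -5, -5, -5, 0, 5, 5, 5, 0, -5, -5, -5;
     5, 5, 5, 0, -5, -5, -5, 0, 5, 5, 5, 0, -5, -5, -5;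
     5, 5, 5, 0, -5, -5, -5, 0, 5, 5, 5, 10, 5, 5, 5;
     -2, 0, 0, 0, -2, 0, 0, 0, -2, 0, 0, 0, -2, 0, 0]

theorem coxeterBasis_mul_invTen : coxeterBasis * coxeterBasisInvTen = (10 : ℚ) • 1 := by
  decide +kernel

theorem isUnit_coxeterBasis : IsUnit coxeterBasis := by
  refine IsUnit.of_mul_eq_one ((10 : ℚ)⁻¹ • coxeterBasisInvTen) ?_
  rw [mul_smul_comm, coxeterBasis_mul_invTen, smul_smul]
  norm_num

theorem det_cartanN (n r : ℕ) : (cartanN n r).det = 1 := by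
  rw [det_of_isUpperTriangular]
  · simp [cartanN]
  · intro i j hij
    exact if_neg fun h => absurd h.1 (not_le.2 hij)

theorem cartanN_transpose_mul_basis :
    (cartanN 15 5)ᵀ * (coxeterBasis * reindex coxeterFormEquiv coxeterFormEquiv coxeterForm) =
      -(cartanN 15 5 * coxeterBasis) := by
  decide +kernel

theorem coxeterN_mul_basis : coxeterN 15 5 * coxeterBasis =
    coxeterBasis * reindex coxeterFormEquiv coxeterFormEquiv coxeterForm := by
  have h : IsUnit (cartanN 15 5)ᵀ.det := by simp [det_transpose, det_cartanN]
  rw [coxeterN, transpose_nonsing_inv, neg_mul, neg_mul, Matrix.mul_assoc, ← Matrix.mul_neg,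
    ← cartanN_transpose_mul_basis, nonsing_inv_mul_cancel_left _ _ h]

/-- The Coxeter polynomial of N₁₅(5) equals (λ+1)(λ⁴+1)(λ⁵+1)², and the Coxeter
number (the multiplicative order of Φ) equals 40. -/
theorem coxeterPoly_15_5 :
    coxeterPolyN 15 5 = (X + 1) * (X ^ 4 + 1) * (X ^ 5 + 1) ^ 2 ∧
    orderOf (coxeterN 15 5) = 40 := by
  obtain ⟨u, hu⟩ := isUnit_coxeterBasis
  have h : coxeterN 15 5 =
      u.val * reindex coxeterFormEquiv coxeterFormEquiv coxeterForm * u⁻¹.val := by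
    rw [Units.eq_mul_inv_iff_mul_eq, hu, coxeterN_mul_basis]
  constructor
  · rw [coxeterPolyN, h, coe_units_inv, charpoly_units_conj, charpoly_reindex, charpoly_coxeterForm]
  · rw [h, ← orderOf_coxeterForm, ← coe_reindexAlgEquiv ℚ,
      ← (reindexAlgEquiv ℚ ℚ coxeterFormEquiv).toMulEquiv.orderOf_eq coxeterForm,
      orderOf_eq_orderOf_iff]
    intro k
    rw [Units.conj_pow, Units.mul_inv_eq_iff_eq_mul, one_mul, u.isUnit.mul_eq_left]
    rfl
end

section
/- For every integer r ≥ 9, the Coxeter polynomial of the Nakayama algebra N_{r+7}(r) equals (λ+1)(λ^6 − λ^3 + 1)(λ^r + 1), where the Coxeter polynomial is the characteristic polynomial of Φ = −C^{-T}·C for the (r+7)×(r+7) Cartan matrix C with C_{ij} = 1 iff i ≤ j ≤ i + r − 1. -/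
open Polynomial Matrix

/-- The coefficient at `(i, j)` of the pencil `x • Cᵀ + C` of the Cartan matrix of `N_n(r)`. -/
def pencilEntry {R : Type*} [CommRing R] (x : R) (r i j : ℕ) : R :=
  (if j ≤ i ∧ i ≤ j + (r - 1) then x else 0) + (if i ≤ j ∧ j ≤ i + (r - 1) then 1 else 0)

theorem coxeterPolyN_eq_det (n r : ℕ) :
    coxeterPolyN n r =
      (Matrix.of fun i j : Fin n => pencilEntry (X : ℚ[X]) r i j).det := by
  have hu : IsUnit (cartanN n r).det := by simp [det_cartanN]
  have hC : ((cartanN n r)ᵀ.map (C : ℚ →+* ℚ[X])).det = 1 := by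
    rw [← RingHom.mapMatrix_apply, ← RingHom.map_det, det_transpose, det_cartanN, map_one]
  have hmul : (cartanN n r)ᵀ * coxeterN n r = -cartanN n r := by
    rw [coxeterN, neg_mul, mul_neg, ← Matrix.mul_assoc, ← transpose_mul,
      nonsing_inv_mul _ hu, transpose_one, Matrix.one_mul]
  rw [coxeterPolyN, Matrix.charpoly, ← one_mul (det _), ← hC, ← det_mul]
  congr 1
  rw [charmatrix, Matrix.mul_sub, RingHom.mapMatrix_apply, ← Matrix.map_mul, hmul]
  ext1 i j
  simp only [Matrix.sub_apply, Matrix.map_apply, Matrix.neg_apply, Matrix.of_apply, pencilEntry,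
    scalar_apply, mul_diagonal, transpose_apply, cartanN]
  split_ifs <;> simp

section TwoRows

variable {m R : Type*} [Fintype m] [DecidableEq m] [CommRing R]

theorem det_updateRow_vecMul (B : Matrix m m R) (a : m) (w : m → R) :
    (B.updateRow a (w ᵥ* B)).det = w a * B.det := by
  rw [← smul_eq_mul, ← det_updateRow_sum, vecMul_eq_sum]

/-- If two combinations of the rows of `B` vanish outside the columns `a` and `c`, the determinant
of `B` splits off a two by two determinant. -/
theorem det_eq_mul_det_toSquareBlockProp (B : Matrix m m R) {a c : m} (hac : a ≠ c) (w w' : m → R)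
    (hwa : w a = 1) (hwa' : w' a = 0) (hwc' : w' c = 1)
    (h : ∀ j, j ≠ a → j ≠ c → (w ᵥ* B) j = 0) (h' : ∀ j, j ≠ a → j ≠ c → (w' ᵥ* B) j = 0) :
    B.det = ((w ᵥ* B) a * (w' ᵥ* B) c - (w ᵥ* B) c * (w' ᵥ* B) a) *
      (toSquareBlockProp B fun i => ¬(i = a ∨ i = c)).det := by
  set B₁ := B.updateRow a (w ᵥ* B) with hB₁
  set B₂ := B₁.updateRow c (w' ᵥ* B) with hB₂
  have hrow : w' ᵥ* B₁ = w' ᵥ* B := by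
    ext j
    refine Finset.sum_congr rfl fun i _ => ?_
    by_cases hi : i = a
    · simp [hi, hwa']
    · simp [hB₁, updateRow_ne hi]
  have hdet : B₂.det = B.det := by
    rw [hB₂, ← hrow, det_updateRow_vecMul, hwc', one_mul, hB₁, det_updateRow_vecMul, hwa, one_mul]
  have hBa : B₂ a = w ᵥ* B := by rw [hB₂, updateRow_ne hac, hB₁, updateRow_self]
  have hBc : B₂ c = w' ᵥ* B := by rw [hB₂, updateRow_self]
  have hB : ∀ i, ¬(i = a ∨ i = c) → B₂ i = B i := by
    intro i hi
    rw [not_or] at hi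
    rw [hB₂, updateRow_ne hi.2, hB₁, updateRow_ne hi.1]
  rw [← hdet, twoBlockTriangular_det' B₂ (fun i => i = a ∨ i = c)]
  · congr 1
    · have hbij : Function.Bijective
          (![⟨a, Or.inl rfl⟩, ⟨c, Or.inr rfl⟩] : Fin 2 → {i // i = a ∨ i = c}) := by
        constructor
        · intro i j hij
          fin_cases i <;> fin_cases j <;> simp_all [hac.symm]
        · rintro ⟨i, rfl | rfl⟩
          · exact ⟨0, rfl⟩
          · exact ⟨1, rfl⟩
      rw [← det_submatrix_equiv_self (Equiv.ofBijective _ hbij), det_fin_two]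
      simp [toSquareBlockProp, hBa, hBc]
    · congr 1
      ext i j
      simp only [toSquareBlockProp_def, Matrix.of_apply]
      rw [hB i i.2]
  · rintro i (rfl | rfl) j hj
    · rw [hBa]; exact h j (fun e => hj (Or.inl e)) fun e => hj (Or.inr e)
    · rw [hBc]; exact h' j (fun e => hj (Or.inl e)) fun e => hj (Or.inr e)

/-- A matrix that is upper triangular for some injective ordering of its index set and has ones on
the diagonal has determinant one. -/
theorem BlockTriangular.det_eq_one {α : Type*} [LinearOrder α] {M : Matrix m m R} {b : m → α}
    (hM : M.BlockTriangular b) (hb : Function.Injective b) (hdiag : ∀ i, M i i = 1) :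
    M.det = 1 := by
  rw [hM.det]
  refine Finset.prod_eq_one fun k hk => ?_
  obtain ⟨i, -, rfl⟩ := Finset.mem_image.1 hk
  have : Subsingleton {j // b j = b i} := ⟨fun p q => Subtype.ext (hb (p.2.trans q.2.symm))⟩
  rw [det_eq_elem_of_subsingleton _ ⟨i, rfl⟩]
  exact hdiag i

end TwoRows

section Pencil

variable {R : Type*} [CommRing R]

/-- The pencil matrix `x • Cᵀ + C` of `N_{k+15}(k+8)` after subtracting from each column its
predecessor. -/
def pencilDiff (x : R) (k : ℕ) : Matrix (Fin (k + 15)) (Fin (k + 15)) R :=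
  fun i j => if (j : ℕ) = 0 then (if (i : ℕ) < k + 8 then x else 0) + (if (i : ℕ) = 0 then 1 else 0)
    else (if (i : ℕ) = j then 1 else 0) + (if (i : ℕ) + 1 = j then -x else 0) +
      (if (i : ℕ) + (k + 8) = j then -1 else 0) + (if (i : ℕ) = j + (k + 7) then x else 0)

theorem det_pencil_eq_det_pencilDiff (x : R) (k : ℕ) :
    (Matrix.of fun i j : Fin (k + 15) => pencilEntry x (k + 8) i j).det =
      (pencilDiff x k).det := by
  refine det_eq_of_forall_col_eq_smul_add_pred (fun _ => 1) (fun i => ?_) fun i j => ?_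
  · simp only [pencilDiff, pencilEntry, Matrix.of_apply, Fin.val_zero]
    congr 1
    · simp; grind
    · simp
  · simp only [pencilDiff, pencilEntry, Matrix.of_apply, Fin.val_succ, Fin.val_castSucc]
    grind

/-- Coefficients at the low and the high rows of a combination of the rows of `pencilDiff`,
prescribed to be `u` and `v` at the rows `0` and `k + 8`. -/
def rowCoeffAux (x u v : R) : ℕ → R × R
  | 0 => (u, v)
  | j + 1 =>
    let p := rowCoeffAux x u v j
    (x * (p.1 - p.2), x * p.2 + x * (p.1 - p.2))

/-- A combination of the rows of `pencilDiff` supported on the columns `0` and `k + 8`. -/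
def rowCoeff (x u v : R) (k j : ℕ) : R :=
  if j ≤ 7 then (rowCoeffAux x u v j).1
  else if j < k + 8 then x ^ (j - 7) * (rowCoeffAux x u v 7).1
  else (rowCoeffAux x u v (j - (k + 8))).2

theorem sum_ite_val_eq {n : ℕ} (f : ℕ → R) (t : ℕ) (ht : t < n) (y : R) :
    ∑ i : Fin n, f i * (if (i : ℕ) = t then y else 0) = f t * y := by
  rw [Finset.sum_eq_single ⟨t, ht⟩]
  · simp
  · intro i _ hi
    rw [if_neg fun e => hi (Fin.ext e), mul_zero]
  · simp

theorem vecMul_pencilDiff_of_ne_zero (x : R) (k : ℕ) (f : ℕ → R) (j : Fin (k + 15))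
    (hj : (j : ℕ) ≠ 0) :
    ((fun i : Fin (k + 15) => f i) ᵥ* pencilDiff x k) j =
      f j - x * f (j - 1) - (if k + 8 ≤ (j : ℕ) then f (j - (k + 8)) else 0) +
        (if (j : ℕ) ≤ 7 then x * f (j + (k + 7)) else 0) := by
  have hjn := j.2
  have h₁ : ∀ i : ℕ, (i + 1 = j) = (i = j - 1) := fun i => by grind
  simp only [vecMul, dotProduct, pencilDiff, if_neg hj, mul_add, Finset.sum_add_distrib, h₁]
  rw [sum_ite_val_eq f _ hjn, sum_ite_val_eq f _ (by omega)]
  have h₂ : ∑ i : Fin (k + 15), f i * (if (i : ℕ) + (k + 8) = j then (-1 : R) else 0) =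
      -(if k + 8 ≤ (j : ℕ) then f (j - (k + 8)) else 0) := by
    split_ifs with h
    · have h' : ∀ i : ℕ, (i + (k + 8) = j) = (i = j - (k + 8)) := fun i => by grind
      simp only [h']
      rw [sum_ite_val_eq f _ (by omega)]
      ring
    · rw [neg_zero]
      refine Finset.sum_eq_zero fun i _ => ?_
      rw [if_neg (by omega), mul_zero]
  have h₃ : ∑ i : Fin (k + 15), f i * (if (i : ℕ) = j + (k + 7) then x else 0) =
      if (j : ℕ) ≤ 7 then x * f (j + (k + 7)) else 0 := by
    split_ifs with h
    · rw [sum_ite_val_eq f _ (by omega), mul_comm]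
    · refine Finset.sum_eq_zero fun i _ => ?_
      rw [if_neg (by omega), mul_zero]
  rw [h₂, h₃]
  ring

theorem vecMul_rowCoeff_eq_zero (x u v : R) (k : ℕ) (j : Fin (k + 15)) (hj : (j : ℕ) ≠ 0)
    (hj' : (j : ℕ) ≠ k + 8) :
    ((fun i : Fin (k + 15) => rowCoeff x u v k i) ᵥ* pencilDiff x k) j = 0 := by
  rw [vecMul_pencilDiff_of_ne_zero x k _ j hj]
  obtain ⟨j, hjn⟩ := j
  obtain ⟨j, rfl⟩ := Nat.exists_eq_succ_of_ne_zero hj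
  simp only [Nat.succ_eq_add_one] at *
  rcases lt_trichotomy (j + 1) (k + 8) with h | h | h
  · rcases Nat.lt_or_ge j 7 with h7 | h7
    · have e : j + 1 + (k + 7) - (k + 8) = j := by omega
      simp only [rowCoeff, if_pos (show j + 1 ≤ 7 by omega), if_neg (show ¬ k + 8 ≤ j + 1 by omega),
        Nat.add_sub_cancel, if_pos (show j ≤ 7 by omega),
        if_neg (show ¬ j + 1 + (k + 7) ≤ 7 by omega),
        if_neg (show ¬ j + 1 + (k + 7) < k + 8 by omega), e, rowCoeffAux]
      ring
    · obtain ⟨i, rfl⟩ := Nat.exists_eq_add_of_le h7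
      have e : 7 + i + 1 - 7 = i + 1 := by omega
      simp only [rowCoeff, if_neg (show ¬ 7 + i + 1 ≤ 7 by omega), if_pos h,
        if_neg (show ¬ k + 8 ≤ 7 + i + 1 by omega), Nat.add_sub_cancel, e]
      rcases Nat.eq_zero_or_pos i with rfl | hi
      · simp
      · rw [if_neg (show ¬ 7 + i ≤ 7 by omega), if_pos (show 7 + i < k + 8 by omega),
          Nat.add_sub_cancel_left]
        ring
  · exact absurd h hj'
  · obtain ⟨i, rfl⟩ := Nat.exists_eq_add_of_le (show k + 8 ≤ j by omega)
    have e : k + 8 + i + 1 - (k + 8) = i + 1 := by omega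
    simp only [rowCoeff, if_neg (show ¬ k + 8 + i + 1 ≤ 7 by omega),
      if_neg (show ¬ k + 8 + i + 1 < k + 8 by omega), e, Nat.add_sub_cancel,
      if_neg (show ¬ k + 8 + i ≤ 7 by omega), if_neg (show ¬ k + 8 + i < k + 8 by omega),
      Nat.add_sub_cancel_left, if_pos (show k + 8 ≤ k + 8 + i + 1 by omega),
      if_pos (show i + 1 ≤ 7 by omega), rowCoeffAux]
    ring

theorem vecMul_rowCoeff_zero (x u v : R) (k : ℕ) (j : Fin (k + 15)) (hj : (j : ℕ) = 0) :
    ((fun i : Fin (k + 15) => rowCoeff x u v k i) ᵥ* pencilDiff x k) j =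
      u + x * (∑ i ∈ Finset.range 8, (rowCoeffAux x u v i).1 +
        (rowCoeffAux x u v 7).1 * ∑ i ∈ Finset.range k, x ^ (i + 1)) := by
  simp only [vecMul, dotProduct, pencilDiff, if_pos hj, mul_add, Finset.sum_add_distrib]
  rw [sum_ite_val_eq _ _ (by omega), add_comm, mul_one]
  congr 1
  rw [Fin.sum_univ_eq_sum_range (fun i => rowCoeff x u v k i * if i < k + 8 then x else 0) (k + 15),
    show k + 15 = 8 + k + 7 by omega, Finset.sum_range_add, Finset.sum_range_add,
    Finset.mul_sum, Finset.mul_sum, Finset.mul_sum]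
  have h₃ : ∑ i ∈ Finset.range 7, (rowCoeff x u v k (8 + k + i) *
      if 8 + k + i < k + 8 then x else 0) = 0 :=
    Finset.sum_eq_zero fun i _ => by rw [if_neg (by omega), mul_zero]
  rw [h₃, add_zero]
  congr 1
  · refine Finset.sum_congr rfl fun i hi => ?_
    have := Finset.mem_range.1 hi
    rw [if_pos (by omega), rowCoeff, if_pos (by omega), mul_comm]
  · refine Finset.sum_congr rfl fun i hi => ?_
    have := Finset.mem_range.1 hi
    rw [if_pos (by omega), rowCoeff, if_neg (by omega), if_pos (by omega),
      show 8 + i - 7 = i + 1 by omega]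
    ring

theorem vecMul_rowCoeff_add_eight (x u v : R) (k : ℕ) (j : Fin (k + 15)) (hj : (j : ℕ) = k + 8) :
    ((fun i : Fin (k + 15) => rowCoeff x u v k i) ᵥ* pencilDiff x k) j =
      v - x ^ (k + 1) * (rowCoeffAux x u v 7).1 - u := by
  have h₀ : rowCoeff x u v k (k + 7) = x ^ k * (rowCoeffAux x u v 7).1 := by
    rcases Nat.eq_zero_or_pos k with rfl | hk
    · simp [rowCoeff]
    · rw [rowCoeff, if_neg (by omega), if_pos (by omega), Nat.add_sub_cancel]
  rw [vecMul_pencilDiff_of_ne_zero x k _ j (by omega), hj, if_pos le_rfl, if_neg (by omega),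
    show k + 8 - 1 = k + 7 by omega, h₀]
  simp [rowCoeff, rowCoeffAux]
  ring

theorem det_toSquareBlockProp_pencilDiff (x : R) (k : ℕ) (a c : Fin (k + 15)) (ha : (a : ℕ) = 0)
    (hc : (c : ℕ) = k + 8) :
    (toSquareBlockProp (pencilDiff x k) fun i => ¬(i = a ∨ i = c)).det = 1 := by
  have hne : ∀ i : {i : Fin (k + 15) // ¬(i = a ∨ i = c)},
      (i.1 : ℕ) ≠ 0 ∧ (i.1 : ℕ) ≠ k + 8 := by
    rintro ⟨i, hi⟩
    simp only [Fin.ext_iff, ha, hc, not_or] at hi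
    exact hi
  refine BlockTriangular.det_eq_one (b := fun i =>
    if (i.1 : ℕ) < k + 8 then 2 * (i.1 : ℕ) else 2 * ((i.1 : ℕ) - (k + 8)) + 1) ?_ ?_ ?_
  · intro i j hij
    have hi := hne i
    have hj := hne j
    have := i.1.2
    have := j.1.2
    simp only [toSquareBlockProp_def, Matrix.of_apply, pencilDiff]
    rw [if_neg hj.1, if_neg, if_neg, if_neg, if_neg] <;> grind
  · intro i j hij
    have hi := hne i
    have hj := hne j
    apply Subtype.ext
    apply Fin.ext
    grind
  · intro i
    have hi := hne i
    simp only [toSquareBlockProp_def, Matrix.of_apply, pencilDiff, if_neg hi.1]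
    simp

theorem det_pencilDiff (x : R) (k : ℕ) :
    (pencilDiff x k).det = (x + 1) * (x ^ 6 - x ^ 3 + 1) * (x ^ (k + 8) + 1) := by
  have hne : (⟨0, by omega⟩ : Fin (k + 15)) ≠ ⟨k + 8, by omega⟩ := by simp
  rw [det_eq_mul_det_toSquareBlockProp (pencilDiff x k) hne
    (fun i => rowCoeff x 1 0 k i) (fun i => rowCoeff x 0 1 k i)
    (by simp [rowCoeff, rowCoeffAux]) (by simp [rowCoeff, rowCoeffAux])
    (by simp [rowCoeff, rowCoeffAux])
    (fun j h h' => vecMul_rowCoeff_eq_zero x 1 0 k j (fun e => h (Fin.ext e))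
      fun e => h' (Fin.ext e))
    (fun j h h' => vecMul_rowCoeff_eq_zero x 0 1 k j (fun e => h (Fin.ext e))
      fun e => h' (Fin.ext e)),
    det_toSquareBlockProp_pencilDiff x k _ _ rfl rfl]
  simp only [vecMul_rowCoeff_zero x _ _ k ⟨0, by omega⟩ rfl,
    vecMul_rowCoeff_add_eight x _ _ k ⟨k + 8, by omega⟩ rfl]
  generalize ∑ i ∈ Finset.range k, x ^ (i + 1) = s
  simp only [Finset.sum_range_succ, Finset.sum_range_zero, rowCoeffAux]
  ring

end Pencil

/-- For every r ≥ 9, the Coxeter polynomial of N_{r+7}(r) equals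
(λ+1)(λ⁶-λ³+1)(λʳ+1). -/
theorem coxeterPoly_r_add_seven (r : ℕ) (hr : 9 ≤ r) :
    coxeterPolyN (r + 7) r = (X + 1) * (X ^ 6 - X ^ 3 + 1) * (X ^ r + 1) := by
  obtain ⟨k, rfl⟩ := Nat.exists_eq_add_of_le' (show 8 ≤ r by omega)
  rw [coxeterPolyN_eq_det, ← det_pencilDiff]
  exact det_pencil_eq_det_pencilDiff X k
end
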